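/- arXiv:1803.11260 — 2 statements merged into one kernel-verified Lean document; each statement's English description precedes it below -/
import Mathlib

section
/- Let (Λ, d) be a strong finitely aligned higher rank graph of rank N and let { T_λ }_{λ∈Λ} be a Toeplitz–Cuntz–Krieger Λ-family on a Hilbert space H. Then { T_λ } is a Cuntz–Krieger Λ-family if and only if it satisfies condition (CK'): Π { T_v − T_μ T_μ* : μ ∈ vΛ^{𝐢}, i ∈ F } = 0 for every non-empty F ⊆ [N] and every F-tracing vertex v. -/
/-- A higher rank graph of rank `N`: a countable small category `Λ` — presented by its set of
morphisms, with the vertices being the (identity) morphisms of degree `0̄` — together with a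
degree functor `d : Λ → ℤ₊^N` satisfying the unique factorization property. -/
structure KGraph (N : ℕ) where
  /-- the morphisms (paths) of the category -/
  Mor : Type
  /-- the category is countable -/
  countable : Countable Mor
  /-- the source vertex of a morphism -/
  src : Mor → Mor
  /-- the range vertex of a morphism -/
  rng : Mor → Mor
  /-- composition `λμ` of morphisms, defined when `s(λ) = r(μ)` -/
  comp : ∀ l m : Mor, src l = rng m → Mor
  /-- the degree functor `d : Λ → ℤ₊^N` -/
  deg : Mor → Fin N → ℕ
  src_src : ∀ l, src (src l) = src l
  rng_src : ∀ l, rng (src l) = src l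
  src_rng : ∀ l, src (rng l) = rng l
  rng_rng : ∀ l, rng (rng l) = rng l
  deg_src : ∀ l, deg (src l) = 0
  deg_rng : ∀ l, deg (rng l) = 0
  /-- vertices (degree-`0̄` morphisms) are identities -/
  src_of_deg_zero : ∀ v, deg v = 0 → src v = v
  rng_of_deg_zero : ∀ v, deg v = 0 → rng v = v
  comp_id : ∀ (l : Mor) (h : src l = rng (src l)), comp l (src l) h = l
  id_comp : ∀ (l : Mor) (h : src (rng l) = rng l), comp (rng l) l h = l
  src_comp : ∀ l m h, src (comp l m h) = src m
  rng_comp : ∀ l m h, rng (comp l m h) = rng l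
  deg_comp : ∀ l m h, deg (comp l m h) = deg l + deg m
  comp_assoc : ∀ (l m n : Mor) (h1 : src l = rng m) (h2 : src m = rng n)
    (h3 : src (comp l m h1) = rng n) (h4 : src l = rng (comp m n h2)),
    comp (comp l m h1) n h3 = comp l (comp m n h2) h4
  /-- unique factorization: existence -/
  factor : ∀ (l : Mor) (m n : Fin N → ℕ), deg l = m + n →
    ∃ (p q : Mor) (h : src p = rng q), comp p q h = l ∧ deg p = m ∧ deg q = n
  /-- unique factorization: uniqueness -/
  factor_unique : ∀ (p q : Mor) (h : src p = rng q) (p' q' : Mor) (h' : src p' = rng q'),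
    comp p q h = comp p' q' h' → deg p = deg p' → p = p' ∧ q = q'

namespace KGraph

variable {N : ℕ} (G : KGraph N)

/-- The `i`-th generator of `ℤ₊^N`. -/
def gen (N : ℕ) (i : Fin N) : Fin N → ℕ := Pi.single i 1

/-- A vertex is a morphism of degree `0̄`. -/
def IsVertex (v : G.Mor) : Prop := G.deg v = 0

/-- `vΛ`, the morphisms with range `v`. -/
def vLam (v : G.Mor) : Set G.Mor := {l | G.rng l = v}

/-- `vΛ^n̄`, the morphisms with range `v` and degree `n̄`. -/
def withRngDeg (v : G.Mor) (n : Fin N → ℕ) : Set G.Mor :=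
  {l | G.rng l = v ∧ G.deg l = n}

/-- `Λ^min(λ,μ)`: the pairs `(α,β)` with `λα = μβ` and `d(λα) = d(λ) ∨ d(μ)`. -/
def minExt (l m : G.Mor) : Set (G.Mor × G.Mor) :=
  {p | ∃ (h1 : G.src l = G.rng p.1) (h2 : G.src m = G.rng p.2),
    G.comp l p.1 h1 = G.comp m p.2 h2 ∧
    G.deg l + G.deg p.1 = G.deg l ⊔ G.deg m ∧
    G.deg m + G.deg p.2 = G.deg l ⊔ G.deg m}

/-- `Λ` is finitely aligned if all the sets `Λ^min(λ,μ)` are finite. -/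
def FinitelyAligned : Prop := ∀ l m : G.Mor, (G.minExt l m).Finite

/-- `Λ` is strong finitely aligned if it is finitely aligned and moreover for every `λ` and
every `i ∉ supp d(λ)` there are only finitely many edges `e ∈ Λ^𝐢` with `Λ^min(λ,e) ≠ ∅`. -/
def StrongFinitelyAligned : Prop :=
  G.FinitelyAligned ∧ ∀ (l : G.Mor) (i : Fin N), G.deg l i = 0 →
    {e : G.Mor | G.deg e = gen N i ∧ (G.minExt l e).Nonempty}.Finite

/-- A subset `S ⊆ vΛ` is exhaustive if every `λ ∈ vΛ` has a common extension with some
member of `S`. -/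
def Exhaustive (v : G.Mor) (S : Set G.Mor) : Prop :=
  ∀ l ∈ G.vLam v, ∃ m ∈ S, (G.minExt l m).Nonempty

/-- A vertex `v` is `F`-tracing if every `λ ∈ vΛ` with `supp d(λ) ∩ F = ∅` satisfies:
`s(λ)Λ^𝐢 ≠ ∅` for at least one `i ∈ F`, and `s(λ)Λ^𝐢` is finite for all `i ∈ [N]`. -/
def FTracing (v : G.Mor) (F : Finset (Fin N)) : Prop :=
  ∀ l ∈ G.vLam v, (∀ i ∈ F, G.deg l i = 0) →
    (∃ i ∈ F, (G.withRngDeg (G.src l) (gen N i)).Nonempty) ∧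
    ∀ i : Fin N, (G.withRngDeg (G.src l) (gen N i)).Finite

/-- A Toeplitz–Cuntz–Krieger `Λ`-family on a Hilbert space `H`. -/
def IsTCK {H : Type} [NormedAddCommGroup H] [InnerProductSpace ℂ H] [CompleteSpace H]
    (T : G.Mor → (H →L[ℂ] H)) : Prop :=
  (∀ v : G.Mor, G.IsVertex v → IsSelfAdjoint (T v) ∧ T v * T v = T v) ∧
  (∀ v w : G.Mor, G.IsVertex v → G.IsVertex w → v ≠ w → T v * T w = 0) ∧
  (∀ (l m : G.Mor) (h : G.src l = G.rng m), T l * T m = T (G.comp l m h)) ∧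
  (∀ l m : G.Mor, G.src l ≠ G.rng m → T l * T m = 0) ∧
  (∀ l m : G.Mor, star (T l) * T m = ∑ᶠ p ∈ G.minExt l m, T p.1 * star (T p.2))

/-- A Cuntz–Krieger `Λ`-family: a TCK family satisfying moreover
`Π_{λ∈S} (T_v − T_λ T_λ*) = 0` for every vertex `v` and every non-empty finite exhaustive
`S ⊆ vΛ` (the factors pairwise commute, so the product is stated for every enumeration
of `S`). -/
def IsCK {H : Type} [NormedAddCommGroup H] [InnerProductSpace ℂ H] [CompleteSpace H]
    (T : G.Mor → (H →L[ℂ] H)) : Prop :=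
  G.IsTCK T ∧
  ∀ v : G.Mor, G.IsVertex v → ∀ S : Set G.Mor, S ⊆ G.vLam v → S.Finite → S.Nonempty →
    G.Exhaustive v S → ∀ L : List G.Mor, L.Nodup → (∀ x, x ∈ L ↔ x ∈ S) →
      (L.map (fun l => T v - T l * star (T l))).prod = 0

end KGraph

namespace KGraph

variable {N : ℕ} (G : KGraph N)

/-- `σ` is an initial segment of `τ`. -/
def IsPrefix (σ τ : G.Mor) : Prop :=
  ∃ (γ : G.Mor) (h : G.src σ = G.rng γ), G.comp σ γ h = τ

variable {G}

theorem IsPrefix.comp {σ γ : G.Mor} (h : G.src σ = G.rng γ) :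
    G.IsPrefix σ (G.comp σ γ h) :=
  ⟨γ, h, rfl⟩

theorem IsPrefix.rng_eq {σ τ : G.Mor} (h : G.IsPrefix σ τ) : G.rng τ = G.rng σ := by
  obtain ⟨γ, h, rfl⟩ := h
  exact G.rng_comp _ _ _

theorem IsPrefix.trans {σ τ ρ : G.Mor} (h₁ : G.IsPrefix σ τ) (h₂ : G.IsPrefix τ ρ) :
    G.IsPrefix σ ρ := by
  obtain ⟨γ, h, rfl⟩ := h₁
  obtain ⟨δ, h', rfl⟩ := h₂
  have hγ : G.src γ = G.rng δ := by rw [← h', G.src_comp]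
  have hσ : G.src σ = G.rng (G.comp γ δ hγ) := by rw [G.rng_comp, h]
  exact ⟨G.comp γ δ hγ, hσ, (G.comp_assoc _ _ _ h hγ h' hσ).symm⟩

/-- Two initial segments of the same path are comparable when their degrees are. -/
theorem IsPrefix.of_deg_le {σ l τ : G.Mor} (h₁ : G.IsPrefix σ τ) (h₂ : G.IsPrefix l τ)
    (hd : G.deg σ ≤ G.deg l) : G.IsPrefix σ l := by
  obtain ⟨γ, hγ, rfl⟩ := h₁
  obtain ⟨δ, hδ, e⟩ := h₂
  obtain ⟨p, q, hpq, rfl, hp, -⟩ :=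
    G.factor l (G.deg σ) (G.deg l - G.deg σ) (add_tsub_cancel_of_le hd).symm
  have hq : G.src q = G.rng δ := by rw [← hδ, G.src_comp]
  have hp' : G.src p = G.rng (G.comp q δ hq) := by rw [G.rng_comp, hpq]
  rw [G.comp_assoc _ _ _ hpq hq hδ hp'] at e
  rw [← (G.factor_unique _ _ _ _ _ _ e hp).1]
  exact .comp hpq

theorem exists_isPrefix_deg_eq {τ : G.Mor} {n : Fin N → ℕ} (h : n ≤ G.deg τ) :
    ∃ σ, G.IsPrefix σ τ ∧ G.deg σ = n := by
  obtain ⟨p, q, hpq, e, hp, -⟩ := G.factor τ n (G.deg τ - n) (add_tsub_cancel_of_le h).symm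
  exact ⟨p, ⟨q, hpq, e⟩, hp⟩

theorem gen_le {n : Fin N → ℕ} {i : Fin N} (h : n i ≠ 0) : gen N i ≤ n := by
  intro j
  by_cases hj : j = i
  · subst hj
    simpa [gen] using Nat.one_le_iff_ne_zero.2 h
  · simp [gen, hj]

theorem id_comp_of_eq {v m : G.Mor} (hv : G.rng m = v) (h : G.src v = G.rng m) :
    G.comp v m h = m := by
  subst hv
  exact G.id_comp m h

theorem minExt_self (l : G.Mor) : G.minExt l l = {(G.src l, G.src l)} := by
  ext ⟨a, b⟩
  simp only [minExt, Set.mem_ofPred_eq, Set.mem_singleton_iff, Prod.mk.injEq]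
  constructor
  · rintro ⟨h₁, h₂, -, h₃, h₄⟩
    simp only [sup_idem, add_eq_left] at h₃ h₄
    exact ⟨by rw [h₁, G.rng_of_deg_zero a h₃], by rw [h₂, G.rng_of_deg_zero b h₄]⟩
  · rintro ⟨rfl, rfl⟩
    exact ⟨(G.rng_src l).symm, (G.rng_src l).symm, rfl, by simp [G.deg_src], by simp [G.deg_src]⟩

/-- A path has a minimal common extension with each of its initial segments. -/
theorem IsPrefix.minExt_nonempty {σ l : G.Mor} (h : G.IsPrefix σ l) :
    (G.minExt l σ).Nonempty := by
  obtain ⟨γ, h, rfl⟩ := h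
  refine ⟨(G.src (G.comp σ γ h), γ), (G.rng_src _).symm, h, G.comp_id _ _, ?_, ?_⟩ <;>
    simp [G.deg_src, G.deg_comp]

/-- In a strong finitely aligned graph every vertex receives finitely many edges of each
colour. -/
theorem StrongFinitelyAligned.finite_withRngDeg (hG : G.StrongFinitelyAligned) {w : G.Mor}
    (hw : G.IsVertex w) (i : Fin N) : (G.withRngDeg w (gen N i)).Finite := by
  refine (hG.2 w i (by rw [show G.deg w = 0 from hw]; rfl)).subset ?_
  rintro e ⟨rfl, he⟩
  exact ⟨he, (e, G.src e), G.src_rng e, (G.rng_src e).symm,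
    by rw [G.id_comp, G.comp_id], by simp [G.deg_rng], by simp [G.deg_rng, G.deg_src]⟩

/-- The edges at an `F`-tracing vertex with colour in `F` form an exhaustive set. -/
theorem FTracing.exhaustive {v : G.Mor} {F : Finset (Fin N)} (h : G.FTracing v F) :
    G.Exhaustive v {x | G.rng x = v ∧ ∃ i ∈ F, G.deg x = gen N i} := by
  intro l hl
  by_cases hF : ∀ i ∈ F, G.deg l i = 0
  · obtain ⟨⟨i, hi, e, he, hd⟩, -⟩ := h l hl hF
    have hle : gen N i ≤ G.deg (G.comp l e he.symm) := by
      rw [G.deg_comp, hd]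
      exact le_add_self
    obtain ⟨f, hf, hfd⟩ := exists_isPrefix_deg_eq hle
    refine ⟨f, ⟨hf.rng_eq.symm.trans ((G.rng_comp _ _ _).trans hl), i, hi, hfd⟩, ?_⟩
    obtain ⟨g, hg, hfg⟩ := hf
    have hsum : G.deg l ⊔ G.deg f = G.deg l + G.deg e := by
      rw [hfd, hd]
      funext j
      by_cases hj : j = i
      · subst hj
        simp [gen, hF j hi]
      · simp [gen, hj]
    refine ⟨(e, g), he.symm, hg, hfg.symm, hsum.symm, ?_⟩
    rw [hsum, ← G.deg_comp f g hg, hfg, G.deg_comp]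
  · push Not at hF
    obtain ⟨i, hi, hne⟩ := hF
    obtain ⟨f, hf, hfd⟩ := exists_isPrefix_deg_eq (gen_le hne)
    exact ⟨f, ⟨hf.rng_eq.symm.trans hl, i, hi, hfd⟩, hf.minExt_nonempty⟩

/-- If `s(λ)` is not `F`-tracing and `λ` is long enough in the directions outside `F`, then `λ`
extends a member of any given exhaustive set. -/
theorem Exhaustive.exists_isPrefix (hG : G.StrongFinitelyAligned) {v : G.Mor} {S : Set G.Mor}
    (hS : G.Exhaustive v S) {l : G.Mor} (hl : G.rng l = v) {F : Finset (Fin N)}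
    (hF : ¬ G.FTracing (G.src l) F) (hlong : ∀ σ ∈ S, ∀ i ∉ F, G.deg σ i ≤ G.deg l i) :
    ∃ σ ∈ S, G.IsPrefix σ l := by
  unfold FTracing at hF
  push Not at hF
  obtain ⟨m, hm, hmF, hm'⟩ := hF
  have hempty : ∀ i ∈ F, G.withRngDeg (G.src m) (gen N i) = ∅ := by
    by_contra hne
    push Not at hne
    obtain ⟨i, hi, hne⟩ := hne
    obtain ⟨j, hj⟩ := hm' ⟨i, hi, hne⟩
    exact hj (hG.finite_withRngDeg (G.deg_src m) j)
  have hlm : G.src l = G.rng m := hm.symm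
  obtain ⟨σ, hσ, ⟨a, b⟩, h₁, h₂, e, hd, -⟩ :=
    hS (G.comp l m hlm) ((G.rng_comp _ _ _).trans hl)
  refine ⟨σ, hσ, .of_deg_le (.comp h₂) (e ▸ (IsPrefix.comp hlm).trans (.comp h₁)) ?_⟩
  intro i
  by_cases hi : i ∈ F
  · have ha : G.deg a i = 0 := by
      by_contra ha
      obtain ⟨f, hf, hfd⟩ := exists_isPrefix_deg_eq (gen_le ha)
      have : f ∈ G.withRngDeg (G.src m) (gen N i) :=
        ⟨by rw [← hf.rng_eq, ← G.src_comp l m hlm]; exact h₁.symm, hfd⟩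
      rw [hempty i hi] at this
      exact this
    have := congrFun hd i
    simp only [Pi.add_apply, Pi.sup_apply, G.deg_comp, ha, hmF i hi, add_zero] at this
    exact this ▸ le_sup_right
  · exact hlong σ hσ i hi

variable {H : Type} [NormedAddCommGroup H] [InnerProductSpace ℂ H] [CompleteSpace H]
  {T : G.Mor → (H →L[ℂ] H)}

namespace IsTCK

theorem mul_eq (hT : G.IsTCK T) {l m : G.Mor} (h : G.src l = G.rng m) :
    T l * T m = T (G.comp l m h) :=
  hT.2.2.1 l m h

theorem rng_mul (hT : G.IsTCK T) {v l : G.Mor} (hv : G.rng l = v) : T v * T l = T l := by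
  have h : G.src v = G.rng l := by rw [← hv, G.src_rng]
  rw [hT.mul_eq h, id_comp_of_eq hv]

theorem star_vertex (hT : G.IsTCK T) {v : G.Mor} (hv : G.IsVertex v) : star (T v) = T v :=
  (hT.1 v hv).1

theorem vertex_proj (hT : G.IsTCK T) {v : G.Mor} (hv : G.IsVertex v) :
    T v * star (T v) = T v := by
  rw [hT.star_vertex hv, (hT.1 v hv).2]

theorem star_mul_self (hT : G.IsTCK T) (l : G.Mor) : star (T l) * T l = T (G.src l) := by
  rw [hT.2.2.2.2, minExt_self, finsum_mem_singleton, hT.vertex_proj (G.deg_src l)]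

theorem star_mul_rng (hT : G.IsTCK T) {v l : G.Mor} (hv : G.IsVertex v) (h : G.rng l = v) :
    star (T l) * T v = star (T l) := by
  rw [← hT.star_vertex hv, ← star_mul, hT.rng_mul h]

theorem star_mul_proj (hT : G.IsTCK T) (l : G.Mor) :
    star (T l) * (T l * star (T l)) = star (T l) := by
  rw [← mul_assoc, hT.star_mul_self, ← hT.star_vertex (G.deg_src l), ← star_mul,
    hT.mul_eq (G.rng_src l).symm, G.comp_id]

/-- The range projections of a Toeplitz–Cuntz–Krieger family decrease along paths. -/
theorem proj_mul_proj_of_isPrefix (hT : G.IsTCK T) {σ l : G.Mor} (h : G.IsPrefix σ l) :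
    T l * star (T l) * (T σ * star (T σ)) = T l * star (T l) := by
  obtain ⟨γ, h, rfl⟩ := h
  rw [← hT.mul_eq h, star_mul, mul_assoc, mul_assoc (star (T γ)), hT.star_mul_proj]

/-- The range projections of a Toeplitz–Cuntz–Krieger family commute. -/
theorem proj_commute (hT : G.IsTCK T) (hG : G.FinitelyAligned) (l m : G.Mor) :
    Commute (T l * star (T l)) (T m * star (T m)) := by
  have hsum : T l * star (T l) * (T m * star (T m)) =
      ∑ p ∈ (hG l m).toFinset, T l * (T p.1 * star (T p.2)) * star (T m) := by
    rw [← Finset.sum_mul, ← Finset.mul_sum, ← finsum_mem_eq_finite_toFinset_sum,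
      ← hT.2.2.2.2 l m]
    simp only [mul_assoc]
  have hsa : star (T l * star (T l) * (T m * star (T m))) =
      T l * star (T l) * (T m * star (T m)) := by
    rw [hsum, star_sum]
    refine Finset.sum_congr rfl fun p hp => ?_
    obtain ⟨h₁, h₂, e, -⟩ := (hG l m).mem_toFinset.1 hp
    have hp' : T l * T p.1 = T m * T p.2 := by rw [hT.mul_eq h₁, e, hT.mul_eq h₂]
    rw [← mul_assoc, mul_assoc, hp', ← star_mul, star_mul, star_star]
  rw [Commute, SemiconjBy, ← hsa]
  simp only [star_mul, star_star]

theorem star_apply_eq_zero (hT : G.IsTCK T) {l : G.Mor} {k : H}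
    (h : (T l * star (T l)) k = 0) : star (T l) k = 0 := by
  rw [← hT.star_mul_proj l, mul_apply_eq_comp, h, map_zero]

end IsTCK

/-- A product of gap projections fixes the vectors orthogonal to all the ranges involved. -/
theorem prod_gap_apply_eq_self {v : G.Mor} {k : H} (hv : T v k = k) {L : List G.Mor}
    (hL : ∀ l ∈ L, star (T l) k = 0) :
    (L.map (fun l => T v - T l * star (T l))).prod k = k := by
  induction L with
  | nil => simp
  | cons a L ih =>
    rw [List.map_cons, List.prod_cons, mul_apply_eq_comp,
      ih fun l hl => hL l (List.mem_cons_of_mem _ hl)]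
    simp [hv, hL a List.mem_cons_self]

/-- The vectors in the range of a product of gap projections are orthogonal to all the ranges
involved. -/
theorem IsTCK.proj_mul_prod_gap (hT : G.IsTCK T) (hG : G.FinitelyAligned) {v : G.Mor}
    (hv : G.IsVertex v) {L : List G.Mor} (hL : ∀ l ∈ L, G.rng l = v) {m : G.Mor} (hm : m ∈ L) :
    T m * star (T m) * (L.map (fun l => T v - T l * star (T l))).prod = 0 := by
  induction L with
  | nil => simp at hm
  | cons a L ih =>
    rw [List.map_cons, List.prod_cons, ← mul_assoc]
    rcases List.mem_cons.1 hm with rfl | hm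
    · rw [mul_sub, mul_assoc, hT.star_mul_rng hv (hL m List.mem_cons_self), mul_assoc,
        hT.star_mul_proj, sub_self, zero_mul]
    · have hc : Commute (T m * star (T m)) (T v - T a * star (T a)) := by
        refine Commute.sub_right ?_ (hT.proj_commute hG m a)
        have := hT.proj_commute hG m v
        rwa [hT.vertex_proj hv] at this
      rw [hc.eq, mul_assoc, ih (fun l hl => hL l (List.mem_cons_of_mem _ hl)) hm, mul_zero]

theorem IsTCK.vertex_mul_prod_gap (hT : G.IsTCK T) {v : G.Mor} (hv : G.IsVertex v)
    {L : List G.Mor} (hL : ∀ l ∈ L, G.rng l = v) (hne : L ≠ []) :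
    T v * (L.map (fun l => T v - T l * star (T l))).prod =
      (L.map (fun l => T v - T l * star (T l))).prod := by
  obtain ⟨a, L, rfl⟩ := List.exists_cons_of_ne_nil hne
  rw [List.map_cons, List.prod_cons, ← mul_assoc, mul_sub, (hT.1 v hv).2, ← mul_assoc,
    hT.rng_mul (hL a List.mem_cons_self)]

/-- The Cuntz–Krieger relations at the edges of `F`-tracing vertices. -/
def IsTracingCK (G : KGraph N) (T : G.Mor → (H →L[ℂ] H)) : Prop :=
  ∀ F : Finset (Fin N), F.Nonempty → ∀ v : G.Mor, G.IsVertex v → G.FTracing v F →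
    ∀ L : List G.Mor, L.Nodup →
      (∀ x : G.Mor, x ∈ L ↔ (G.rng x = v ∧ ∃ i ∈ F, G.deg x = gen N i)) →
      (L.map (fun l => T v - T l * star (T l))).prod = 0

/-- Under the relations at tracing vertices, no non-zero vector in the range of `T_λ`
is orthogonal to the ranges of all `T_{λe}`, with `e` an edge of colour in `F`, when `s(λ)` is `F`-tracing. -/
theorem IsTracingCK.eq_zero_of_fTracing (hCK : G.IsTracingCK T) (hT : G.IsTCK T) {l : G.Mor}
    {F : Finset (Fin N)} (hF : G.FTracing (G.src l) F) {k : H}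
    (hk : (T l * star (T l)) k = k)
    (hkF : ∀ j ∈ F, ∀ τ, G.IsPrefix l τ → G.deg τ = G.deg l + gen N j →
      (T τ * star (T τ)) k = 0) : k = 0 := by
  obtain ⟨⟨i, hi, -⟩, hfin⟩ := hF (G.src l) (G.rng_src l) (by simp [G.deg_src])
  rw [G.src_src] at hfin
  have hE : {x | G.rng x = G.src l ∧ ∃ i ∈ F, G.deg x = gen N i}.Finite := by
    refine (Set.finite_iUnion hfin).subset ?_
    rintro x ⟨hx, i, -, hd⟩
    exact Set.mem_iUnion.2 ⟨i, hx, hd⟩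
  have hprod := hCK F ⟨i, hi⟩ (G.src l) (G.deg_src l) hF hE.toFinset.toList
    (Finset.nodup_toList _) (by simp)
  have hfix := prod_gap_apply_eq_self (T := T) (v := G.src l) (k := star (T l) k)
    (L := hE.toFinset.toList)
    (by rw [← hT.star_mul_self, mul_apply_eq_comp]
        exact congrArg _ hk) (by
      intro e he
      simp only [Finset.mem_toList, Set.Finite.mem_toFinset, Set.mem_ofPred_eq] at he
      obtain ⟨he, j, hj, hd⟩ := he
      have := hT.star_apply_eq_zero
        (hkF j hj (G.comp l e he.symm) (.comp he.symm) (by rw [G.deg_comp, hd]))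
      rwa [← hT.mul_eq, star_mul] at this)
  rw [hprod] at hfix
  rw [← hk, mul_apply_eq_comp, ← hfix]
  simp

/-- Under the relations at tracing vertices, a vector orthogonal to the ranges of an exhaustive
family of bounded degree vanishes, provided it lies in the range of some `T_λ` and is orthogonal to the ranges of the
`T_{λe}` with `e` an edge of colour in `F`. -/
theorem IsTracingCK.eq_zero_of_exhaustive (hCK : G.IsTracingCK T) (hT : G.IsTCK T)
    (hG : G.StrongFinitelyAligned) {v : G.Mor} {S : Set G.Mor} (hS : G.Exhaustive v S) {M : ℕ}
    (hM : ∀ σ ∈ S, ∀ i, G.deg σ i ≤ M) (F : Finset (Fin N)) (l : G.Mor) (hl : G.rng l = v)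
    (k : H) (hkS : ∀ σ ∈ S, (T σ * star (T σ)) k = 0) (hk : (T l * star (T l)) k = k)
    (hkF : ∀ j ∈ F, ∀ τ, G.IsPrefix l τ → G.deg τ = G.deg l + gen N j →
      (T τ * star (T τ)) k = 0) : k = 0 := by
  have hcomm : ∀ a b : G.Mor, ∀ x : H, (T a * star (T a)) ((T b * star (T b)) x) =
      (T b * star (T b)) ((T a * star (T a)) x) := fun a b x =>
    DFunLike.congr_fun (hT.proj_commute hG.1 a b).eq x
  have hpre : ∀ {a b : G.Mor}, G.IsPrefix a b → ∀ {x : H}, (T a * star (T a)) x = 0 →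
      (T b * star (T b)) x = 0 := fun {a b} hab {x} hx => by
    rw [← hT.proj_mul_proj_of_isPrefix hab, mul_apply_eq_comp, hx, map_zero]
  by_cases hlong : ∀ i ∉ F, M ≤ G.deg l i
  · by_cases hF : G.FTracing (G.src l) F
    · exact hCK.eq_zero_of_fTracing hT hF hk hkF
    · obtain ⟨σ, hσ, hσl⟩ := hS.exists_isPrefix hG hl hF
        fun σ hσ i hi => (hM σ hσ i).trans (hlong i hi)
      rw [← hk]
      exact hpre hσl (hkS σ hσ)
  · push Not at hlong
    obtain ⟨i, hi, hlt⟩ := hlong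
    have hiF : i ∈ Fᶜ := Finset.mem_compl.2 hi
    refine hCK.eq_zero_of_exhaustive hT hG hS hM (insert i F) l hl k hkS hk ?_
    intro j hj τ hτ hd
    rcases Finset.mem_insert.1 hj with rfl | hj
    · refine hCK.eq_zero_of_exhaustive hT hG hS hM F τ (hτ.rng_eq.trans hl) _ ?_ ?_ ?_
      · intro σ hσ
        rw [hcomm, hkS σ hσ, map_zero]
      · rw [← mul_apply_eq_comp, mul_assoc, hT.star_mul_proj]
      · intro j' hj' ρ hρ hρd
        have hle : G.deg l + gen N j' ≤ G.deg ρ := by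
          rw [hρd, hd, add_right_comm]
          exact le_self_add
        obtain ⟨ρ', hρ', hρd'⟩ := exists_isPrefix_deg_eq hle
        have hlρ : G.IsPrefix l ρ' :=
          .of_deg_le (hτ.trans hρ) hρ' (hρd' ▸ le_self_add)
        rw [hcomm, hpre hρ' (hkF j' hj' ρ' hlρ hρd'), map_zero]
    · exact hkF j hj τ hτ hd
termination_by ∑ i ∈ Fᶜ, (M - G.deg l i)
decreasing_by
  · refine Finset.sum_lt_sum (fun i' _ => ?_) ⟨_, hiF, ?_⟩
    · rw [hd, Pi.add_apply]
      omega
    · rw [hd, Pi.add_apply]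
      simp only [gen, Pi.single_eq_same]
      omega
  · rw [Finset.compl_insert]
    exact Finset.sum_erase_lt_of_pos hiF (Nat.sub_pos_of_lt hlt)

end KGraph

/-- Let `Λ` be a strong finitely aligned higher rank graph of rank `N` and `{T_λ}` a
Toeplitz–Cuntz–Krieger `Λ`-family on a Hilbert space `H`.  Then `{T_λ}` is a Cuntz–Krieger
`Λ`-family if and only if it satisfies condition (CK'):
`Π { T_v − T_μ T_μ* : μ ∈ vΛ^𝐢, i ∈ F } = 0` for every non-empty `F ⊆ [N]` and every
`F`-tracing vertex `v` (the products being stated over every enumeration of the relevant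
index set, as the factors pairwise commute). -/
theorem KGraph.isCK_iff_CK' {N : ℕ} (G : KGraph N) (hG : G.StrongFinitelyAligned)
    {H : Type} [NormedAddCommGroup H] [InnerProductSpace ℂ H] [CompleteSpace H]
    (T : G.Mor → (H →L[ℂ] H)) (hT : G.IsTCK T) :
    G.IsCK T ↔
      ∀ F : Finset (Fin N), F.Nonempty → ∀ v : G.Mor, G.IsVertex v → G.FTracing v F →
        ∀ L : List G.Mor, L.Nodup →
          (∀ x : G.Mor, x ∈ L ↔ (G.rng x = v ∧ ∃ i ∈ F, G.deg x = KGraph.gen N i)) →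
          (L.map (fun l => T v - T l * star (T l))).prod = 0 := by
  constructor
  · rintro ⟨-, hCK⟩ F - v hv hF L hL hmem
    have hex := hF.exhaustive
    obtain ⟨m, hm, -⟩ := hex v (G.rng_of_deg_zero v hv)
    exact hCK v hv _ (fun x hx => hx.1)
      (L.finite_toSet.subset fun x hx => (hmem x).2 hx) ⟨m, hm⟩ hex L hL hmem
  · intro hCK
    refine ⟨hT, fun v hv S hSv hSfin hSne hS L _ hmem => ?_⟩
    have hrng : ∀ l ∈ L, G.rng l = v := fun l hl => hSv ((hmem l).1 hl)
    have hne : L ≠ [] := by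
      obtain ⟨x, hx⟩ := hSne
      exact List.ne_nil_of_mem ((hmem x).2 hx)
    obtain ⟨M, hM⟩ := (hSfin.image fun σ => Finset.univ.sup (G.deg σ)).bddAbove
    ext x
    refine IsTracingCK.eq_zero_of_exhaustive hCK hT hG hS (M := M) (fun σ hσ i => ?_) ∅ v
      (G.rng_of_deg_zero v hv) _ (fun σ hσ => ?_) ?_ (by simp)
    · exact (Finset.le_sup (Finset.mem_univ i)).trans (hM (Set.mem_image_of_mem _ hσ))
    · rw [← mul_apply_eq_comp,
        hT.proj_mul_prod_gap hG.1 hv hrng ((hmem σ).2 hσ), zero_apply]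
    · rw [hT.vertex_proj hv, ← mul_apply_eq_comp,
        hT.vertex_mul_prod_gap hv hrng hne]
end

section
/- Let Λ* ⊆ (F⁺_d)^N be a factorial language. Then Λ* is sofic if and only if there exist a higher rank graph (Λ, d) of rank N with finitely many vertices and a labeling 𝔏 of Λ over d symbols such that Λ* = 𝔏(Λ), the labeled path space of (Λ, 𝔏). -/
/-- The `N`-fold direct product of the free monoid on `d` generators,
with coordinatewise multiplication. -/
abbrev MWord (d N : ℕ) : Type := Fin N → FreeMonoid (Fin d)

/-- The element of `(F⁺_d)^N` whose `i`-th coordinate is the one-letter word `k`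
and whose other coordinates are empty. -/
def delta (d N : ℕ) (i : Fin N) (k : Fin d) : MWord d N :=
  fun j => if j = i then FreeMonoid.of k else 1

/-- `ν` is a factor of `μ` if `μ = w * ν * q` for some `w, q`. -/
def IsFactor {d N : ℕ} (ν μ : MWord d N) : Prop :=
  ∃ w q : MWord d N, μ = w * ν * q

/-- A factorial language in `(F⁺_d)^N`. -/
def IsFL {d N : ℕ} (Λ : Set (MWord d N)) : Prop :=
  (∀ i : Fin N, ∃ k : Fin d, delta d N i k ∈ Λ) ∧
  ∀ μ ∈ Λ, ∀ ν : MWord d N, IsFactor ν μ → ν ∈ Λ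

/-- The multilength of a multiword. -/
def mlen {d N : ℕ} (μ : MWord d N) : Fin N → ℕ := fun i => (μ i).length

/-- The relation `∼_n̄` on a language: equality of left multipliers of multilength `≤ n̄`. -/
def simRel {d N : ℕ} (Λ : Set (MWord d N)) (n : Fin N → ℕ) (μ ν : MWord d N) : Prop :=
  ∀ w : MWord d N, mlen w ≤ n → (w * μ ∈ Λ ↔ w * ν ∈ Λ)

/-- The relation `∼` on a language: equality of all left multipliers. -/
def simFull {d N : ℕ} (Λ : Set (MWord d N)) (μ ν : MWord d N) : Prop :=
  ∀ w : MWord d N, w * μ ∈ Λ ↔ w * ν ∈ Λ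

section MultiwordLemmas

variable {d N : ℕ}

theorem mlen_one : mlen (1 : MWord d N) = 0 := by
  funext i
  exact FreeMonoid.length_one

theorem mlen_mul (μ ν : MWord d N) : mlen (μ * ν) = mlen μ + mlen ν := by
  funext i
  exact FreeMonoid.length_mul _ _

theorem eq_one_of_mlen_eq_zero {μ : MWord d N} (h : mlen μ = 0) : μ = 1 := by
  funext i
  exact FreeMonoid.length_eq_zero.1 (congrFun h i)

theorem mul_eq_mul_of_mlen_eq {p q p' q' : MWord d N} (h : p * q = p' * q')
    (hl : mlen p = mlen p') : p = p' ∧ q = q' := by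
  have key (i : Fin N) : p i = p' i ∧ q i = q' i :=
    List.append_inj (congrFun h i) (congrFun hl i)
  exact ⟨funext fun i => (key i).1, funext fun i => (key i).2⟩

theorem exists_eq_mul_of_mlen_eq_add {w : MWord d N} {m n : Fin N → ℕ} (h : mlen w = m + n) :
    ∃ p q : MWord d N, p * q = w ∧ mlen p = m ∧ mlen q = n := by
  have hi (i : Fin N) : (FreeMonoid.toList (w i)).length = m i + n i := congrFun h i
  refine ⟨fun i => FreeMonoid.ofList ((FreeMonoid.toList (w i)).take (m i)),
    fun i => FreeMonoid.ofList ((FreeMonoid.toList (w i)).drop (m i)), ?_, ?_, ?_⟩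
  · funext i
    exact List.take_append_drop (m i) (FreeMonoid.toList (w i))
  · funext i
    change ((FreeMonoid.toList (w i)).take (m i)).length = m i
    rw [List.length_take, hi]
    omega
  · funext i
    change ((FreeMonoid.toList (w i)).drop (m i)).length = n i
    rw [List.length_drop, hi]
    omega

theorem exists_eq_delta_of_mlen_eq_gen {w : MWord d N} {i : Fin N}
    (h : mlen w = KGraph.gen N i) : ∃ k : Fin d, w = delta d N i k := by
  have hlen (j : Fin N) : (w j).length = KGraph.gen N i j := congrFun h j
  have hi : (w i).length = 1 := by rw [hlen, KGraph.gen, Pi.single_eq_same]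
  obtain ⟨k, hk⟩ := FreeMonoid.length_eq_one.1 hi
  refine ⟨k, funext fun j => ?_⟩
  by_cases hj : j = i
  · subst hj
    simpa [delta] using hk
  · have hj0 : (w j).length = 0 := by rw [hlen, KGraph.gen, Pi.single_eq_of_ne hj]
    simpa [delta, hj] using FreeMonoid.length_eq_zero.1 hj0

theorem finite_setOf_mlen_le (m : Fin N → ℕ) : {w : MWord d N | mlen w ≤ m}.Finite := by
  refine (Set.Finite.pi' fun i => List.finite_length_le (Fin d) (m i)).subset ?_
  exact fun w hw i => hw i

instance : Countable (MWord d N) :=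
  inferInstanceAs (Countable (Fin N → List (Fin d)))

end MultiwordLemmas

section LeftMultipliers

variable {d N : ℕ}

/-- The set of left multipliers `{w : w * μ ∈ Λ}` of `μ` in the language `Λ`. -/
def leftMul (Λ : Set (MWord d N)) (μ : MWord d N) : Set (MWord d N) := {w | w * μ ∈ Λ}

theorem simFull_iff_leftMul_eq {Λ : Set (MWord d N)} {μ ν : MWord d N} :
    simFull Λ μ ν ↔ leftMul Λ μ = leftMul Λ ν :=
  Set.ext_iff.symm

theorem leftMul_mul (Λ : Set (MWord d N)) (w μ : MWord d N) :
    leftMul Λ (w * μ) = {u | u * w ∈ leftMul Λ μ} := by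
  ext u
  simp only [leftMul, Set.mem_ofPred_eq, mul_assoc]

/-- Soficity is finiteness of the set of classes of `∼`. -/
theorem sofic_iff_finite_leftMul_image (Λ : Set (MWord d N)) :
    (∃ m : Fin N → ℕ, ∀ n : Fin N → ℕ, m ≤ n →
        ∀ μ ∈ Λ, ∀ ν ∈ Λ, (simRel Λ n μ ν ↔ simFull Λ μ ν)) ↔
      (leftMul Λ '' Λ).Finite := by
  constructor
  · rintro ⟨m, hm⟩
    refine Set.Finite.of_finite_image (f := fun S => S ∩ {w | mlen w ≤ m}) ?_ ?_
    · refine (finite_setOf_mlen_le m).finite_subsets.subset ?_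
      rintro _ ⟨S, -, rfl⟩
      exact Set.inter_subset_right
    · rintro _ ⟨μ, hμ, rfl⟩ _ ⟨ν, hν, rfl⟩ h
      rw [← simFull_iff_leftMul_eq, ← hm m le_rfl μ hμ ν hν]
      intro w hw
      have := Set.ext_iff.1 h w
      simpa [leftMul, hw] using this
  · intro hfin
    have hsep (S T : Set (MWord d N)) : ∃ w, S ≠ T → ¬(w ∈ S ↔ w ∈ T) := by
      by_cases h : S = T
      · exact ⟨1, fun h' => absurd h h'⟩
      · obtain ⟨w, hw⟩ := not_forall.1 (mt Set.ext h)
        exact ⟨w, fun _ => hw⟩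
    choose sep hsep using hsep
    refine ⟨(hfin.toFinset ×ˢ hfin.toFinset).sup fun p => mlen (sep p.1 p.2), ?_⟩
    intro n hn μ hμ ν hν
    refine ⟨fun h => ?_, fun h w _ => h w⟩
    rw [simFull_iff_leftMul_eq]
    by_contra hne
    refine hsep _ _ hne (h _ (le_trans ?_ hn))
    refine Finset.le_sup (f := fun p : Set (MWord d N) × Set (MWord d N) => mlen (sep p.1 p.2))
      (b := (leftMul Λ μ, leftMul Λ ν)) ?_
    simp only [Finset.mem_product, Set.Finite.mem_toFinset]
    exact ⟨⟨μ, hμ, rfl⟩, ⟨ν, hν, rfl⟩⟩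

end LeftMultipliers

section FollowerGraph

variable {d N : ℕ}

/-- The morphisms of the follower graph of `Λ`: pairs `(w, S)` of a class `S` of `∼` (encoded by
its set of left multipliers) and a left multiplier `w ∈ S`, with source `S`. -/
def FollowerMor (Λ : Set (MWord d N)) : Type :=
  {p : MWord d N × Set (MWord d N) // p.2 ∈ leftMul Λ '' Λ ∧ p.1 ∈ p.2}

namespace FollowerMor

variable {Λ : Set (MWord d N)}

/-- The word labeling a morphism. -/
def word (l : FollowerMor Λ) : MWord d N := l.1.1

/-- The class at which a morphism starts. -/
def source (l : FollowerMor Λ) : Set (MWord d N) := l.1.2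

/-- The class at which a morphism ends. -/
def target (l : FollowerMor Λ) : Set (MWord d N) := {u | u * l.word ∈ l.source}

theorem ext {l m : FollowerMor Λ} (hw : l.word = m.word) (hs : l.source = m.source) : l = m :=
  Subtype.ext (Prod.ext hw hs)

theorem source_mem (l : FollowerMor Λ) : l.source ∈ leftMul Λ '' Λ := l.2.1

theorem word_mem_source (l : FollowerMor Λ) : l.word ∈ l.source := l.2.2

theorem target_mem (l : FollowerMor Λ) : l.target ∈ leftMul Λ '' Λ := by
  obtain ⟨μ, -, hS⟩ := l.source_mem
  have hw := l.word_mem_source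
  rw [← hS] at hw
  refine ⟨l.word * μ, hw, ?_⟩
  rw [leftMul_mul, hS, target]

theorem one_mem_of_mem_image {S : Set (MWord d N)} (hS : S ∈ leftMul Λ '' Λ) : 1 ∈ S := by
  obtain ⟨μ, hμ, rfl⟩ := hS
  simpa [leftMul] using hμ

/-- The identity morphism at a class. -/
def vertex (S : Set (MWord d N)) (hS : S ∈ leftMul Λ '' Λ) : FollowerMor Λ :=
  ⟨(1, S), hS, one_mem_of_mem_image hS⟩

/-- The composite of two composable morphisms. -/
def comp (l m : FollowerMor Λ) (h : l.source = m.target) : FollowerMor Λ :=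
  ⟨(l.word * m.word, m.source), m.source_mem, by
    have hl := l.word_mem_source
    rw [h] at hl
    exact hl⟩

@[simp] theorem word_vertex (S : Set (MWord d N)) (hS : S ∈ leftMul Λ '' Λ) :
    (vertex S hS).word = 1 := rfl

@[simp] theorem source_vertex (S : Set (MWord d N)) (hS : S ∈ leftMul Λ '' Λ) :
    (vertex S hS).source = S := rfl

@[simp] theorem target_vertex (S : Set (MWord d N)) (hS : S ∈ leftMul Λ '' Λ) :
    (vertex S hS).target = S := by
  ext u
  simp [target]

@[simp] theorem word_comp (l m : FollowerMor Λ) (h : l.source = m.target) :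
    (l.comp m h).word = l.word * m.word := rfl

@[simp] theorem source_comp (l m : FollowerMor Λ) (h : l.source = m.target) :
    (l.comp m h).source = m.source := rfl

@[simp] theorem target_comp (l m : FollowerMor Λ) (h : l.source = m.target) :
    (l.comp m h).target = l.target := by
  ext u
  simp only [target, word_comp, source_comp, Set.mem_ofPred_eq, h, mul_assoc]

theorem vertex_congr {S T : Set (MWord d N)} {hS : S ∈ leftMul Λ '' Λ} {hT : T ∈ leftMul Λ '' Λ}
    (h : S = T) : vertex S hS = vertex T hT :=
  ext rfl h

theorem eq_of_vertex_eq {S T : Set (MWord d N)} {hS : S ∈ leftMul Λ '' Λ}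
    {hT : T ∈ leftMul Λ '' Λ} (h : vertex S hS = vertex T hT) : S = T :=
  congrArg source h

theorem vertex_source_of_word_eq_one {l : FollowerMor Λ} (h : l.word = 1) :
    vertex l.source l.source_mem = l :=
  ext h.symm rfl

theorem vertex_target_of_word_eq_one {l : FollowerMor Λ} (h : l.word = 1) :
    vertex l.target l.target_mem = l := by
  refine ext h.symm ?_
  ext u
  simp [target, h]

instance : Countable (FollowerMor Λ) := by
  have : Countable (leftMul Λ '' Λ) := (Λ.to_countable.image _).to_subtype
  refine Function.Injective.countable
    (f := fun l : FollowerMor Λ => (l.word, (⟨l.source, l.source_mem⟩ : leftMul Λ '' Λ))) ?_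
  intro l m h
  obtain ⟨hw, hs⟩ := Prod.mk.inj h
  exact ext hw (congrArg Subtype.val hs)

theorem exists_comp_eq (hΛ : ∀ μ ∈ Λ, ∀ ν, IsFactor ν μ → ν ∈ Λ) (l : FollowerMor Λ) {m n : Fin N → ℕ} (h : mlen l.word = m + n) :
    ∃ (p q : FollowerMor Λ) (hpq : p.source = q.target),
      p.comp q hpq = l ∧ mlen p.word = m ∧ mlen q.word = n := by
  obtain ⟨a, b, hab, ha, hb⟩ := exists_eq_mul_of_mlen_eq_add h
  obtain ⟨μ, -, hS⟩ := l.source_mem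
  have hw : a * b * μ ∈ Λ := by
    have := l.word_mem_source
    rwa [← hS, ← hab] at this
  have hbμ : b ∈ l.source := by
    rw [← hS]
    exact hΛ _ hw _ ⟨a, 1, by rw [mul_one, mul_assoc]⟩
  let q : FollowerMor Λ := ⟨(b, l.source), l.source_mem, hbμ⟩
  have hq : a * b ∈ l.source := hab ▸ l.word_mem_source
  exact ⟨⟨(a, q.target), q.target_mem, hq⟩, q, rfl, ext hab rfl, ha, hb⟩

end FollowerMor

/-- The follower graph of a language: its vertices are the classes of `∼`, and every left
multiplier `w` of `μ` gives a path from the class of `μ` to the class of `w * μ`. -/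
def followerGraph (Λ : Set (MWord d N)) (hΛ : ∀ μ ∈ Λ, ∀ ν, IsFactor ν μ → ν ∈ Λ) :
    KGraph N where
  Mor := FollowerMor Λ
  countable := inferInstance
  src l := .vertex l.source l.source_mem
  rng l := .vertex l.target l.target_mem
  comp l m h := l.comp m (FollowerMor.eq_of_vertex_eq h)
  deg l := mlen l.word
  src_src _ := rfl
  rng_src _ := FollowerMor.vertex_congr (FollowerMor.target_vertex _ _)
  src_rng _ := rfl
  rng_rng _ := FollowerMor.vertex_congr (FollowerMor.target_vertex _ _)
  deg_src _ := mlen_one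
  deg_rng _ := mlen_one
  src_of_deg_zero _ h := FollowerMor.vertex_source_of_word_eq_one (eq_one_of_mlen_eq_zero h)
  rng_of_deg_zero _ h := FollowerMor.vertex_target_of_word_eq_one (eq_one_of_mlen_eq_zero h)
  comp_id l _ := FollowerMor.ext (mul_one _) rfl
  id_comp l _ := FollowerMor.ext (one_mul _) rfl
  src_comp _ _ _ := rfl
  rng_comp _ _ _ := FollowerMor.vertex_congr (FollowerMor.target_comp _ _ _)
  deg_comp _ _ _ := mlen_mul _ _
  comp_assoc _ _ _ _ _ _ _ := FollowerMor.ext (mul_assoc _ _ _) rfl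
  factor l m n h := by
    obtain ⟨p, q, hpq, hl, hp, hq⟩ := l.exists_comp_eq hΛ h
    exact ⟨p, q, FollowerMor.vertex_congr hpq, hl, hp, hq⟩
  factor_unique p q h p' q' h' hc hd := by
    obtain ⟨hp, hq⟩ := mul_eq_mul_of_mlen_eq (congrArg FollowerMor.word hc) hd
    have hs := congrArg FollowerMor.source hc
    have hq' : q = q' := FollowerMor.ext hq hs
    subst hq'
    exact ⟨FollowerMor.ext hp ((FollowerMor.eq_of_vertex_eq h).trans
      (FollowerMor.eq_of_vertex_eq h').symm), rfl⟩

end FollowerGraph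

theorem KGraph.finite_leftMul_image_range {d N : ℕ} (G : KGraph N) (L : G.Mor → MWord d N)
    (hfin : {v : G.Mor | G.IsVertex v}.Finite)
    (hmul : ∀ (l m : G.Mor) (h : G.src l = G.rng m), L (G.comp l m h) = L l * L m)
    (hlen : ∀ l : G.Mor, mlen (L l) = G.deg l) :
    (leftMul (Set.range L) '' Set.range L).Finite := by
  let R : MWord d N → Set G.Mor := fun μ => {v | ∃ b, L b = μ ∧ G.rng b = v}
  have key (μ : MWord d N) :
      leftMul (Set.range L) μ = {w | ∃ a, L a = w ∧ G.src a ∈ R μ} := by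
    ext w
    constructor
    · rintro ⟨l, hl⟩
      obtain ⟨a, b, hab, rfl, ha, hb⟩ := G.factor l (mlen w) (mlen μ)
        (by rw [← hlen, hl, mlen_mul])
      rw [hmul] at hl
      obtain ⟨haw, hbμ⟩ := mul_eq_mul_of_mlen_eq hl (by rw [hlen, ha])
      exact ⟨a, haw, b, hbμ, hab.symm⟩
    · rintro ⟨a, rfl, b, rfl, hab⟩
      exact ⟨G.comp a b hab.symm, hmul _ _ _⟩
  refine (hfin.finite_subsets.image
    fun S : Set G.Mor => {w : MWord d N | ∃ a, L a = w ∧ G.src a ∈ S}).subset ?_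
  rintro _ ⟨μ, -, rfl⟩
  refine ⟨R μ, ?_, (key μ).symm⟩
  rintro _ ⟨b, -, rfl⟩
  exact G.deg_rng b

/-- A factorial language `Λ* ⊆ (F⁺_d)^N` is sofic if and only if there exist a higher rank
graph `(Λ, d)` of rank `N` with finitely many vertices and a labeling `𝔏` of `Λ` over `d`
symbols (multiplicative, degree-compatible, sending an edge of color `i` to some `δ_i(k)`)
such that `Λ*` is the labeled path space `𝔏(Λ)`. -/
theorem sofic_iff_labeled_path_space {d N : ℕ} (Λs : Set (MWord d N)) (hFL : IsFL Λs) :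
    (∃ m : Fin N → ℕ, ∀ n : Fin N → ℕ, m ≤ n →
        ∀ μ ∈ Λs, ∀ ν ∈ Λs, (simRel Λs n μ ν ↔ simFull Λs μ ν)) ↔
    (∃ (G : KGraph N) (L : G.Mor → MWord d N),
      {v : G.Mor | G.IsVertex v}.Finite ∧
      (∀ (l m : G.Mor) (h : G.src l = G.rng m), L (G.comp l m h) = L l * L m) ∧
      (∀ l : G.Mor, mlen (L l) = G.deg l) ∧
      (∀ (e : G.Mor) (i : Fin N), G.deg e = KGraph.gen N i → ∃ k : Fin d, L e = delta d N i k) ∧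
      Λs = Set.range L) := by
  rw [sofic_iff_finite_leftMul_image]
  constructor
  · intro hfin
    refine ⟨followerGraph Λs hFL.2, FollowerMor.word, ?_, fun _ _ _ => rfl, fun _ => rfl,
      fun _ _ he => exists_eq_delta_of_mlen_eq_gen he, ?_⟩
    · refine Set.Finite.of_finite_image (f := FollowerMor.source)
        (hfin.subset (Set.image_subset_iff.2 fun v _ => FollowerMor.source_mem v)) ?_
      intro v hv v' hv' h
      exact FollowerMor.ext
        ((eq_one_of_mlen_eq_zero hv).trans (eq_one_of_mlen_eq_zero hv').symm) h
    · ext w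
      constructor
      · intro hw
        have h1 : (1 : MWord d N) ∈ Λs := hFL.2 w hw 1 ⟨w, 1, by simp⟩
        exact ⟨⟨(w, leftMul Λs 1), ⟨1, h1, rfl⟩, by simpa [leftMul] using hw⟩, rfl⟩
      · rintro ⟨l, rfl⟩
        obtain ⟨μ, -, hS⟩ := l.source_mem
        have hl := l.word_mem_source
        rw [← hS] at hl
        exact hFL.2 _ hl _ ⟨1, μ, by rw [one_mul]⟩
  · rintro ⟨G, L, hfin, hmul, hlen, -, rfl⟩
    exact G.finite_leftMul_image_range L hfin hmul hlen
end
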